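/- arXiv:0805.2410 — 2 statements merged into one kernel-verified Lean document; each statement's English description precedes it below -/
import Mathlib

section
/- Let n be a natural number and let G be a symmetric n×n integer matrix with det G ≠ 0. Declare two characteristic vectors α, β of G equivalent if α − β ∈ 2Gℤⁿ (i.e., α − β = 2Gx for some x ∈ ℤⁿ). Then the map sending a characteristic vector α to the class of (α − diag(G))/2 in ℤⁿ/Gℤⁿ induces a bijection between the set of equivalence classes of characteristic vectors modulo 2Gℤⁿ and the quotient group ℤⁿ/Gℤⁿ; in particular, the number of equivalence classes of characteristic vectors modulo 2Gℤⁿ equals |det G|. -/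
open Matrix

/-- `α` is a characteristic vector for `G`: for every `v ∈ ℤⁿ`,
`α ⬝ᵥ v ≡ vᵀGv (mod 2)`. -/
def IsCharVec (n : ℕ) (G : Matrix (Fin n) (Fin n) ℤ) (α : Fin n → ℤ) : Prop :=
  ∀ v : Fin n → ℤ, α ⬝ᵥ v ≡ v ⬝ᵥ (G *ᵥ v) [ZMOD 2]

/-- Modulo 2, the quadratic form of a symmetric integer matrix is the linear form given by its
diagonal. -/
theorem Matrix.IsSymm.dotProduct_mulVec_modEq_two {ι : Type*} [Fintype ι] [DecidableEq ι]
    {G : Matrix ι ι ℤ} (hG : G.IsSymm) (v : ι → ℤ) :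
    v ⬝ᵥ (G *ᵥ v) ≡ G.diag ⬝ᵥ v [ZMOD 2] := by
  let q : (ι → ℤ) →+ ZMod 2 := AddMonoidHom.mk' (fun v => ((v ⬝ᵥ (G *ᵥ v) : ℤ) : ZMod 2)) (by
    intro v w
    have hsymm : w ⬝ᵥ (G *ᵥ v) = v ⬝ᵥ (G *ᵥ w) := by
      rw [dotProduct_mulVec, ← mulVec_transpose, hG.eq, dotProduct_comm]
    have htwo : ((2 : ℤ) : ZMod 2) = 0 := rfl
    have hadd : (v + w) ⬝ᵥ (G *ᵥ (v + w)) =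
        v ⬝ᵥ (G *ᵥ v) + w ⬝ᵥ (G *ᵥ w) + 2 * (v ⬝ᵥ (G *ᵥ w)) := by
      rw [mulVec_add, add_dotProduct, dotProduct_add, dotProduct_add, hsymm]
      ring
    rw [hadd, Int.cast_add, Int.cast_add, Int.cast_mul, htwo, zero_mul, add_zero])
  let l : (ι → ℤ) →+ ZMod 2 := AddMonoidHom.mk' (fun v => ((G.diag ⬝ᵥ v : ℤ) : ZMod 2)) (by
    intro v w
    rw [dotProduct_add, Int.cast_add])
  have hql : q = l := by
    ext i
    simp [q, l]
  exact (ZMod.intCast_eq_intCast_iff _ _ 2).1 (DFunLike.congr_fun hql v)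

/-- A vector is characteristic for a symmetric matrix iff it is congruent to the diagonal
modulo 2. -/
theorem isCharVec_iff {n : ℕ} {G : Matrix (Fin n) (Fin n) ℤ} (hG : G.IsSymm) {α : Fin n → ℤ} :
    IsCharVec n G α ↔ ∀ i, 2 ∣ α i - G i i := by
  constructor
  · intro h i
    have hi := (h (Pi.single i 1)).trans (hG.dotProduct_mulVec_modEq_two _)
    simp only [dotProduct_single_one, diag_apply] at hi
    exact hi.symm.dvd
  · intro h v
    refine Int.ModEq.trans ?_ (hG.dotProduct_mulVec_modEq_two v).symm
    refine (Int.modEq_iff_dvd.2 ?_).symm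
    rw [← sub_dotProduct]
    exact Finset.dvd_sum fun i _ => (h i).mul_right _

/-- The cokernel of a nonsingular integer matrix has cardinality `|det G|`. -/
theorem Matrix.card_quotient_range_mulVecLin {ι : Type*} [Fintype ι] [DecidableEq ι]
    {G : Matrix ι ι ℤ} (hdet : G.det ≠ 0) :
    Nat.card ((ι → ℤ) ⧸ LinearMap.range G.mulVecLin) = G.det.natAbs := by
  have hinj : Function.Injective G.mulVecLin := mulVec_injective_of_det_ne_zero hdet
  rw [← Submodule.natAbs_det_equiv _ (LinearEquiv.ofInjective G.mulVecLin hinj),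
    ← LinearMap.det_toLin', toLin'_apply']
  rfl

/-- For symmetric `G` with `det G ≠ 0`, the map `α ↦ [(α - diag G)/2] ∈ ℤⁿ/Gℤⁿ` is
constant on equivalence classes of characteristic vectors mod `2Gℤⁿ`, separates distinct
classes, and is surjective; hence it induces a bijection between the set of classes and
`ℤⁿ/Gℤⁿ`, and in particular the number of classes equals `|det G|`. -/
theorem char_classes_equiv_quotient (n : ℕ) (G : Matrix (Fin n) (Fin n) ℤ)
    (hG : G.IsSymm) (hdet : G.det ≠ 0) :
    (∀ α β : Fin n → ℤ, IsCharVec n G α → IsCharVec n G β →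
      ((Submodule.Quotient.mk (fun i => (α i - G i i) / 2) :
          (Fin n → ℤ) ⧸ LinearMap.range G.mulVecLin) =
        Submodule.Quotient.mk (fun i => (β i - G i i) / 2) ↔
          ∃ x : Fin n → ℤ, α - β = 2 • (G *ᵥ x))) ∧
    (∀ q : (Fin n → ℤ) ⧸ LinearMap.range G.mulVecLin,
      ∃ α : Fin n → ℤ, IsCharVec n G α ∧
        (Submodule.Quotient.mk (fun i => (α i - G i i) / 2) :
          (Fin n → ℤ) ⧸ LinearMap.range G.mulVecLin) = q) ∧
    Nat.card {C : Set (Fin n → ℤ) | ∃ α : Fin n → ℤ, IsCharVec n G α ∧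
        C = {β : Fin n → ℤ | IsCharVec n G β ∧ ∃ x : Fin n → ℤ, β - α = 2 • (G *ᵥ x)}} =
      G.det.natAbs := by
  have hmk : ∀ α β : Fin n → ℤ, IsCharVec n G α → IsCharVec n G β →
      ((Submodule.Quotient.mk (fun i => (α i - G i i) / 2) :
          (Fin n → ℤ) ⧸ LinearMap.range G.mulVecLin) =
        Submodule.Quotient.mk (fun i => (β i - G i i) / 2) ↔
          ∃ x : Fin n → ℤ, α - β = 2 • (G *ᵥ x)) := by
    intro α β hα hβ
    rw [isCharVec_iff hG] at hα hβ
    rw [Submodule.Quotient.eq, LinearMap.mem_range]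
    refine exists_congr fun x => ?_
    simp only [funext_iff, mulVecLin_apply, Pi.sub_apply, two_nsmul, Pi.add_apply]
    refine forall_congr' fun i => ?_
    have := hα i
    have := hβ i
    lia
  have hsurj : ∀ q : (Fin n → ℤ) ⧸ LinearMap.range G.mulVecLin,
      ∃ α : Fin n → ℤ, IsCharVec n G α ∧
        (Submodule.Quotient.mk (fun i => (α i - G i i) / 2) :
          (Fin n → ℤ) ⧸ LinearMap.range G.mulVecLin) = q := by
    intro q
    obtain ⟨y, rfl⟩ := Submodule.Quotient.mk_surjective _ q
    refine ⟨fun i => G i i + 2 * y i, (isCharVec_iff hG).2 fun i => by simp, ?_⟩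
    congr 1
    ext i
    simp
  refine ⟨hmk, hsurj, ?_⟩
  rw [← card_quotient_range_mulVecLin hdet]
  choose a ha hqa using hsurj
  refine (Nat.card_congr (Equiv.ofBijective (fun q => ⟨_, a q, ha q, rfl⟩) ⟨?_, ?_⟩)).symm
  · intro p q hpq
    have hmem : a p ∈ {β | IsCharVec n G β ∧ ∃ x : Fin n → ℤ, β - a q = 2 • (G *ᵥ x)} :=
      (Subtype.ext_iff.1 hpq).subset ⟨ha p, 0, by simp⟩
    rw [← hqa p, ← hqa q]
    exact (hmk _ _ (ha p) (ha q)).2 hmem.2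
  · rintro ⟨_, α, hα, rfl⟩
    refine ⟨Submodule.Quotient.mk fun i => (α i - G i i) / 2, Subtype.ext (Set.ext fun β => ?_)⟩
    refine and_congr_right fun hβ => ?_
    rw [← hmk _ _ hβ (ha _), ← hmk _ _ hβ hα, hqa]
end

section
/- Let n be a natural number and let G be a symmetric, negative definite n×n integer matrix. Let α₀ ∈ ℤⁿ be a characteristic vector for G. Then the set of rational numbers {αᵀG⁻¹α : α ∈ α₀ + 2Gℤⁿ} is bounded above and attains its maximum; that is, there exists α ∈ α₀ + 2Gℤⁿ such that αᵀG⁻¹α ≥ βᵀG⁻¹β for every β ∈ α₀ + 2Gℤⁿ. -/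
open Matrix

/-- The rational number `αᵀ G⁻¹ α`, computed with the inverse of `G` over `ℚ`. -/
noncomputable def quadQ (n : ℕ) (G : Matrix (Fin n) (Fin n) ℤ) (α : Fin n → ℤ) : ℚ :=
  (fun i => (α i : ℚ)) ⬝ᵥ ((G.map ((↑) : ℤ → ℚ))⁻¹ *ᵥ fun i => (α i : ℚ))

/-- A rational matrix whose quadratic form is negative on nonzero vectors is invertible. -/
theorem isUnit_det_of_quadratic_neg {n : ℕ} {A : Matrix (Fin n) (Fin n) ℚ}
    (hA : ∀ v : Fin n → ℚ, v ≠ 0 → v ⬝ᵥ (A *ᵥ v) < 0) : IsUnit A.det := by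
  rw [isUnit_iff_ne_zero]
  intro hdet
  obtain ⟨v, hv, hAv⟩ := exists_mulVec_eq_zero_iff.mpr hdet
  simpa [hAv] using hA v hv

/-- If `G` is negative definite, then `αᵀG⁻¹α ≤ 0`. -/
theorem quadQ_nonpos {n : ℕ} {G : Matrix (Fin n) (Fin n) ℤ}
    (hneg : ∀ v : Fin n → ℚ, v ≠ 0 → v ⬝ᵥ ((G.map ((↑) : ℤ → ℚ)) *ᵥ v) < 0)
    (α : Fin n → ℤ) : quadQ n G α ≤ 0 := by
  have hdet := isUnit_det_of_quadratic_neg hneg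
  unfold quadQ
  set A := G.map ((↑) : ℤ → ℚ)
  set a : Fin n → ℚ := fun i => (α i : ℚ)
  have ha : A *ᵥ (A⁻¹ *ᵥ a) = a := by
    rw [mulVec_mulVec, mul_nonsing_inv A hdet, one_mulVec]
  rcases eq_or_ne (A⁻¹ *ᵥ a) 0 with h0 | h0
  · simp [h0]
  · have h := hneg _ h0
    rw [ha, dotProduct_comm] at h
    exact h.le

/-- If `det G ≠ 0`, then `det G * αᵀG⁻¹α` is the integer `αᵀ adj(G) α`. -/
theorem det_mul_quadQ {n : ℕ} {G : Matrix (Fin n) (Fin n) ℤ}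
    (hdet : IsUnit (G.map ((↑) : ℤ → ℚ)).det) (α : Fin n → ℤ) :
    (G.map ((↑) : ℤ → ℚ)).det * quadQ n G α = ((α ⬝ᵥ (G.adjugate *ᵥ α) : ℤ) : ℚ) := by
  have hadj : (G.map ((↑) : ℤ → ℚ)).adjugate = G.adjugate.map ((↑) : ℤ → ℚ) :=
    ((Int.castRingHom ℚ).map_adjugate G).symm
  rw [quadQ, inv_def, smul_mulVec, dotProduct_smul, smul_eq_mul, ← mul_assoc,
    Ring.mul_inverse_cancel _ hdet, one_mul, hadj]
  simp [dotProduct, mulVec]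

/-- For symmetric negative definite `G` and a characteristic vector `α₀`, the values
`αᵀG⁻¹α` on the coset `α₀ + 2Gℤⁿ` attain a maximum. -/
theorem quad_max_exists_on_coset (n : ℕ) (G : Matrix (Fin n) (Fin n) ℤ) (hG : G.IsSymm)
    (hneg : ∀ v : Fin n → ℚ, v ≠ 0 → v ⬝ᵥ ((G.map ((↑) : ℤ → ℚ)) *ᵥ v) < 0)
    (α₀ : Fin n → ℤ) (hα₀ : IsCharVec n G α₀) :
    ∃ α : Fin n → ℤ, (∃ x : Fin n → ℤ, α = α₀ + 2 • (G *ᵥ x)) ∧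
      ∀ β : Fin n → ℤ, (∃ x : Fin n → ℤ, β = α₀ + 2 • (G *ᵥ x)) →
        quadQ n G β ≤ quadQ n G α := by
  have hdet := isUnit_det_of_quadratic_neg hneg
  let N : (Fin n → ℤ) → ℤ := fun α => α ⬝ᵥ (G.adjugate *ᵥ α)
  have habs : ∀ α, ((N α).natAbs : ℚ) = |(G.map ((↑) : ℤ → ℚ)).det| * -quadQ n G α := by
    intro α
    rw [← abs_of_nonpos (quadQ_nonpos hneg α), ← abs_mul, det_mul_quadQ hdet,
      Nat.cast_natAbs, Int.cast_abs]
  let f : (Fin n → ℤ) → ℕ := fun x => (N (α₀ + 2 • (G *ᵥ x))).natAbs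
  refine ⟨_, ⟨Function.argmin f, rfl⟩, ?_⟩
  rintro _ ⟨x, rfl⟩
  have hmin : (f (Function.argmin f) : ℚ) ≤ f x := by
    exact_mod_cast Function.argmin_le f x
  simp only [f, habs] at hmin
  exact neg_le_neg_iff.mp (le_of_mul_le_mul_left hmin (abs_pos.mpr hdet.ne_zero))
end
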